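/- Inverse multiplier operators: for every θ ≥ 0 there exists a constant c > 0 such that for all ε ∈ (0,1/2), all ℓ ∈ ℝ, all j ∈ {t, n}, and all f : 𝕋 → ℝ³ with ‖f‖_{H^{ℓ+θ}} < ∞: ‖T_{(m_ε^j)^{−θ}} f‖_{H^ℓ} ≤ c|log ε|^{−θ}‖f‖_{H^{ℓ+θ}}, where T_{(m_ε^j)^{−θ}} is the Fourier multiplier operator with symbol m_ε^j(k)^{−θ}. -/

import Mathlib

open scoped Real BigOperators
open MeasureTheory

noncomputable section

namespace Filament

/-- ℝ³. -/
abbrev V : Type := EuclideanSpace ℝ (Fin 3)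
/-- ℂ³. -/
abbrev VC : Type := EuclideanSpace ℂ (Fin 3)

/-- Fourier coefficient `ℱ[h](k) = ∫_𝕋 h(s) e^{2πiks} ds` of a (1-periodic) complex valued
function on the unit torus, viewed as a function on `ℝ`. -/
def fc (h : ℝ → ℂ) (k : ℤ) : ℂ :=
  ∫ s in (0:ℝ)..1, h s * Complex.exp (2 * (Real.pi : ℂ) * Complex.I * (k : ℂ) * (s : ℂ))

/-- Componentwise Fourier coefficient of an ℝ³-valued function. -/
def fcV (h : ℝ → V) (k : ℤ) : VC :=
  (WithLp.equiv 2 (Fin 3 → ℂ)).symm (fun i => fc (fun s => ((h s i : ℝ) : ℂ)) k)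

/-- Fourier coefficient of a real scalar function. -/
def fcR (h : ℝ → ℝ) (k : ℤ) : ℂ := fc (fun s => ((h s : ℝ) : ℂ)) k

/-- Squared inhomogeneous Sobolev norm `‖h‖_{H^σ}²`. -/
def HsqV (σ : ℝ) (h : ℝ → V) : ℝ := ∑' k : ℤ, (1 + (k:ℝ)^2) ^ σ * ‖fcV h k‖^2

/-- Sobolev norm `‖h‖_{H^σ}`. -/
def HnV (σ : ℝ) (h : ℝ → V) : ℝ := Real.sqrt (HsqV σ h)

/-- Squared inhomogeneous Sobolev norm of a scalar function. -/
def HsqR (σ : ℝ) (h : ℝ → ℝ) : ℝ := ∑' k : ℤ, (1 + (k:ℝ)^2) ^ σ * ‖fcR h k‖^2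

/-- Sobolev norm of a scalar function. -/
def HnR (σ : ℝ) (h : ℝ → ℝ) : ℝ := Real.sqrt (HsqR σ h)

/-- Squared homogeneous Sobolev seminorm `‖h‖_{Ḣ^σ}²` (the `k = 0` mode is omitted). -/
def HdotsqV (σ : ℝ) (h : ℝ → V) : ℝ :=
  ∑' k : {k : ℤ // k ≠ 0}, (|((k : ℤ) : ℝ)|) ^ (2*σ) * ‖fcV h k‖^2

/-- Homogeneous Sobolev seminorm `‖h‖_{Ḣ^σ}`. -/
def HdotV (σ : ℝ) (h : ℝ → V) : ℝ := Real.sqrt (HdotsqV σ h)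

/-- Membership `h ∈ H^σ(𝕋; ℝ³)`. -/
def MemHV (σ : ℝ) (h : ℝ → V) : Prop :=
  Summable (fun k : ℤ => (1 + (k:ℝ)^2) ^ σ * ‖fcV h k‖^2)

/-- Membership `h ∈ H^σ(𝕋; ℝ)`. -/
def MemHR (σ : ℝ) (h : ℝ → ℝ) : Prop :=
  Summable (fun k : ℤ => (1 + (k:ℝ)^2) ^ σ * ‖fcR h k‖^2)

/-- Modified Bessel function of the second kind of (integer) order `j`:
`K_j(x) = ∫₀^∞ e^{−x cosh t} cosh (j t) dt`. -/
def besselK (j : ℕ) (x : ℝ) : ℝ :=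
  ∫ t in Set.Ioi (0:ℝ), Real.exp (-x * Real.cosh t) * Real.cosh ((j : ℝ) * t)

/-- `|log ε|` for `0 < ε < 1`. -/
def logn (ε : ℝ) : ℝ := -Real.log ε

/-- The tangential slender body multiplier `m_ε^t`. -/
def mt (ε : ℝ) : ℤ → ℝ := fun k =>
  if k = 0 then logn ε / (2 * Real.pi) else
    let x := 2 * Real.pi * ε * |(k : ℝ)|
    let K0 := besselK 0 x
    let K1 := besselK 1 x
    (2*K0*K1 + x * (K0^2 - K1^2)) / (8 * Real.pi^2 * ε * |(k:ℝ)| * K1^2)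

/-- The normal slender body multiplier `m_ε^n`. -/
def mn (ε : ℝ) : ℤ → ℝ := fun k =>
  if k = 0 then logn ε / (4 * Real.pi) else
    let x := 2 * Real.pi * ε * |(k : ℝ)|
    let K0 := besselK 0 x
    let K1 := besselK 1 x
    let K2 := besselK 2 x
    (2*K0*K1*K2 + x * (K1^2*(K0+K2) - 2*K0^2*K2))
      / (4 * Real.pi^2 * ε * |(k:ℝ)| * (4*K1^2*K2 + x * K1 * (K1^2 - K0*K2)))

/-- Fourier multiplier operator with symbol `m`, on complex scalar functions:
`(T_m h)(s) = Σ_k m(k) ℱ[h](k) e^{−2πiks}`. -/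
def TmC (m : ℤ → ℝ) (h : ℝ → ℂ) : ℝ → ℂ :=
  fun s => ∑' k : ℤ, (m k : ℂ) * fc h k *
    Complex.exp (-(2 * (Real.pi : ℂ) * Complex.I * (k : ℂ) * (s : ℂ)))

/-- Fourier multiplier operator with (real) symbol `m` acting componentwise on ℝ³-valued
functions. -/
def Tm (m : ℤ → ℝ) (h : ℝ → V) : ℝ → V :=
  fun s => (WithLp.equiv 2 (Fin 3 → ℝ)).symm
    (fun i => (TmC m (fun t => ((h t i : ℝ) : ℂ)) s).re)

/-- Euclidean dot product on ℝ³. -/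
def dotV (x y : V) : ℝ := ∑ i, x i * y i

/-- `a · conj b` for `a b : ℂ³`. -/
def fdot (a b : VC) : ℂ := ∑ i, a i * (starRingEnd ℂ) (b i)

/-- Tangential projection `P_{u} h = (u·h) u` (with `u = X_s`). -/
def Ptan (u h : ℝ → V) : ℝ → V := fun s => dotV (u s) (h s) • u s

/-- Normal projection `P⊥_{u} h = h − (u·h) u`. -/
def Pperp (u h : ℝ → V) : ℝ → V := fun s => h s - Ptan u h s

/-- The force-to-velocity map `ℒ̄_ε` along a curve with unit tangent `u = X_s`. -/
def Leps (ε : ℝ) (u f : ℝ → V) : ℝ → V :=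
  fun s => Ptan u (Tm (mt ε) (Ptan u f)) s + Pperp u (Tm (mn ε) (Pperp u f)) s

/-- A (1-periodic) curve of Sobolev regularity `σ` parametrized by arclength:
`X ∈ H^σ(𝕋;ℝ³)` with `|X_s| = 1` a.e. -/
structure IsCurve (σ : ℝ) (X : ℝ → V) : Prop where
  periodic : Function.Periodic X 1
  mem : MemHV σ X
  unit : ∀ᵐ s : ℝ, ‖deriv X s‖ = 1

/-- The tangential part `(X_s · X_ssss) X_s` of `X_ssss`. -/
def tangential4 (X : ℝ → V) : ℝ → V :=
  fun s => dotV (deriv X s) (iteratedDeriv 4 X s) • deriv X s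

/-- `τ` is a weak solution of the tension equation
`(ℒ̄_ε[(τX_s)_s])_s·X_s = (ℒ̄_ε[X_ssss])_s·X_s`. -/
def WeakTension (ε : ℝ) (X : ℝ → V) (τ : ℝ → ℝ) : Prop :=
  ∀ φ : ℝ → ℝ, Function.Periodic φ 1 → MemHR 1 φ →
    (∑' k : ℤ,
      ((mt ε k : ℂ) * fdot (fcV (fun s => deriv φ s • deriv X s) k)
          (fcV (fun s => deriv τ s • deriv X s) k)
        + (mn ε k : ℂ) * fdot (fcV (fun s => φ s • iteratedDeriv 2 X s) k)
          (fcV (fun s => τ s • iteratedDeriv 2 X s) k)))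
    = ∑' k : ℤ,
      ((mt ε k : ℂ) * fdot (fcV (fun s => deriv φ s • deriv X s) k) (fcV (tangential4 X) k)
        + (mn ε k : ℂ) * fdot (fcV (fun s => φ s • iteratedDeriv 2 X s) k)
          (fcV (Pperp (deriv X) (iteratedDeriv 4 X)) k))

/-- The remainder `R[X] = ℒ̄_ε[∂_s⁴X] − T_{m_ε^n}(∂_s⁴X)`. -/
def Rop (ε : ℝ) (X : ℝ → V) : ℝ → V :=
  fun s => Leps ε (deriv X) (iteratedDeriv 4 X) s - Tm (mn ε) (iteratedDeriv 4 X) s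

/-- `ℒ̄_ε[(τ X_s)_s] = P_{X_s} T_{m_ε^t}(τ_s X_s) + P⊥_{X_s} T_{m_ε^n}(τ X_ss)`. -/
def tensionForce (ε : ℝ) (X : ℝ → V) (τ : ℝ → ℝ) : ℝ → V :=
  fun s => Ptan (deriv X) (Tm (mt ε) (fun r => deriv τ r • deriv X r)) s
         + Pperp (deriv X) (Tm (mn ε) (fun r => τ r • iteratedDeriv 2 X r)) s

/-- The symbol `λ_k = m_ε^n(k) (2πk)⁴` of `A = T_{m_ε^n} ∂_s⁴`. -/
def lamb (ε : ℝ) (k : ℤ) : ℝ := mn ε k * (2 * Real.pi * (k:ℝ))^4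

/-- The semigroup `e^{−t a A}`, i.e. the multiplier with symbol `e^{−a λ_k t}`
(`a` is a time-rescaling factor; `a = 1` is the unrescaled evolution). -/
def heat (ε a t : ℝ) (h : ℝ → V) : ℝ → V :=
  Tm (fun k => Real.exp (-(a * lamb ε k) * t)) h

/-- `X` is a solution on `[0,T]` of the (time-rescaled by `a`) filament evolution
`∂ₜX = −a ℒ̄_ε[(X_sss − τX_s)_s]`, `|X_s|² = 1`, with initial data `X0` and tension field `τ`,
in the mild (Duhamel) formulation, belonging to `C([0,T];H²) ∩ L²([0,T];H^{7/2})`. -/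
structure IsSolutionOn (ε a T : ℝ) (X0 : ℝ → V) (X : ℝ → ℝ → V) (τ : ℝ → ℝ → ℝ) : Prop where
  curve : ∀ t ∈ Set.Icc (0:ℝ) T, IsCurve 2 (X t)
  contH2 : ∀ t ∈ Set.Icc (0:ℝ) T, ∀ δ > (0:ℝ), ∃ η > (0:ℝ), ∀ t' ∈ Set.Icc (0:ℝ) T,
      |t' - t| < η → HnV 2 (fun s => X t' s - X t s) < δ
  l2H : IntegrableOn (fun t => HsqV (7/2) (X t)) (Set.Icc 0 T)
  init : X 0 = X0
  tension : ∀ᵐ r ∂(volume.restrict (Set.Icc (0:ℝ) T)),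
      Function.Periodic (τ r) 1 ∧ MemHR (1/2) (τ r) ∧ WeakTension ε (X r) (τ r)
  duhamel : ∀ t ∈ Set.Icc (0:ℝ) T, ∀ s : ℝ,
      X t s = heat ε a t X0 s
        + ∫ r in (0:ℝ)..t,
            (heat ε a (t - r)
              (fun y => a • (tensionForce ε (X r) (τ r) y - Rop ε (X r) y))) s

/-- `(I + u ⊗ u) w`. -/
def rftApply (u w : ℝ → V) : ℝ → V := fun s => w s + dotV (u s) (w s) • u s

/-- `Y` is a solution on `[0,T]` of the time-rescaled resistive force theory evolution
`∂ₜY = −(1/(4π))(I + Y_s⊗Y_s)(Y_sss − τ_Y Y_s)_s`, `|Y_s| = 1`, with initial data `X0` and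
RFT tension `τY`, belonging to `C([0,T];H⁴) ∩ L²([0,T];H⁶)`. -/
structure IsRFTSolutionOn (T : ℝ) (X0 : ℝ → V) (Y : ℝ → ℝ → V) (τY : ℝ → ℝ → ℝ) : Prop where
  curve : ∀ t ∈ Set.Icc (0:ℝ) T, Function.Periodic (Y t) 1 ∧ MemHV 4 (Y t) ∧
      (∀ᵐ s : ℝ, ‖deriv (Y t) s‖ = 1)
  contH4 : ∀ t ∈ Set.Icc (0:ℝ) T, ∀ δ > (0:ℝ), ∃ η > (0:ℝ), ∀ t' ∈ Set.Icc (0:ℝ) T,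
      |t' - t| < η → HnV 4 (fun s => Y t' s - Y t s) < δ
  l2H : IntegrableOn (fun t => HsqV 6 (Y t)) (Set.Icc 0 T)
  init : Y 0 = X0
  tension : ∀ t ∈ Set.Icc (0:ℝ) T, Function.Periodic (τY t) 1 ∧ MemHR 1 (τY t) ∧
      ∀ s : ℝ,
        dotV (deriv (rftApply (deriv (Y t))
            (fun x => deriv (fun y => τY t y • deriv (Y t) y) x)) s) (deriv (Y t) s)
        = dotV (deriv (rftApply (deriv (Y t)) (iteratedDeriv 4 (Y t))) s) (deriv (Y t) s)
  evol : ∀ t ∈ Set.Icc (0:ℝ) T, ∀ s : ℝ,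
      HasDerivAt (fun r => Y r s)
        (-((1/(4*Real.pi)) • rftApply (deriv (Y t))
            (fun x => deriv (fun y => iteratedDeriv 3 (Y t) y - τY t y • deriv (Y t) y) x) s)) t

/-- The moment `∫₀^∞ e^{−x cosh t} (cosh t)^n dt`. -/
def coshMoment (n : ℕ) (x : ℝ) : ℝ :=
  ∫ t in Set.Ioi (0:ℝ), Real.exp (-x * Real.cosh t) * Real.cosh t ^ n

lemma tendsto_cosh_atTop : Filter.Tendsto Real.cosh Filter.atTop Filter.atTop := by
  refine Filter.tendsto_atTop_mono (fun t => ?_)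
    (Real.tendsto_exp_atTop.atTop_div_const (by norm_num : (0:ℝ) < 2))
  rw [Real.cosh_eq]
  have := Real.exp_pos (-t)
  linarith

lemma tendsto_exp_mul_cosh_pow {x : ℝ} (hx : 0 < x) (n : ℕ) :
    Filter.Tendsto (fun t => Real.exp (-x * Real.cosh t) * Real.cosh t ^ n) Filter.atTop
      (nhds 0) := by
  have h := ((Real.tendsto_pow_mul_exp_neg_atTop_nhds_zero n).comp
    (tendsto_cosh_atTop.const_mul_atTop hx)).const_mul ((x ^ n)⁻¹)
  rw [mul_zero] at h
  refine h.congr fun t => ?_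
  have : x ^ n ≠ 0 := (pow_pos hx n).ne'
  simp only [Function.comp_apply, mul_pow, neg_mul]
  field_simp

lemma integrableOn_exp_mul_cosh_pow {x : ℝ} (hx : 0 < x) (n : ℕ) :
    IntegrableOn (fun t => Real.exp (-x * Real.cosh t) * Real.cosh t ^ n) (Set.Ioi 0) := by
  refine integrable_of_isBigO_exp_neg one_pos (by fun_prop) ?_
  refine Asymptotics.IsBigO.of_bound 2 ?_
  filter_upwards [(tendsto_exp_mul_cosh_pow hx (n + 1)).eventually_le_const one_pos] with t ht
  have hc := Real.cosh_pos t
  rw [Real.norm_of_nonneg (by positivity), Real.norm_of_nonneg (by positivity)]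
  have h1 : Real.exp (-1 * t) * Real.exp t = 1 := by rw [← Real.exp_add]; simp
  have h2 : Real.exp t ≤ 2 * Real.cosh t := by
    rw [Real.cosh_eq]
    have := Real.exp_pos (-t)
    linarith
  have h3 : 1 ≤ 2 * Real.exp (-1 * t) * Real.cosh t := by
    nlinarith [mul_le_mul_of_nonneg_left h2 (Real.exp_pos (-1 * t)).le]
  refine le_of_mul_le_mul_right ?_ hc
  calc _ = Real.exp (-x * Real.cosh t) * Real.cosh t ^ (n + 1) := by ring
    _ ≤ _ := ht.trans h3

lemma coshMoment_pos {x : ℝ} (hx : 0 < x) (n : ℕ) : 0 < coshMoment n x := by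
  have hp : ∀ t, 0 < Real.exp (-x * Real.cosh t) * Real.cosh t ^ n := fun t =>
    mul_pos (Real.exp_pos _) (pow_pos (Real.cosh_pos t) n)
  rw [coshMoment, setIntegral_pos_iff_support_of_nonneg_ae
    (Filter.Eventually.of_forall fun t => (hp t).le) (integrableOn_exp_mul_cosh_pow hx n)]
  have : Function.support (fun t => Real.exp (-x * Real.cosh t) * Real.cosh t ^ n) = Set.univ :=
    Set.eq_univ_of_forall fun t => (hp t).ne'
  rw [this]
  simp

lemma besselK_zero (x : ℝ) : besselK 0 x = coshMoment 0 x := by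
  simp [besselK, coshMoment]

lemma besselK_one (x : ℝ) : besselK 1 x = coshMoment 1 x := by
  simp [besselK, coshMoment]

lemma besselK_two {x : ℝ} (hx : 0 < x) :
    besselK 2 x = 2 * coshMoment 2 x - coshMoment 0 x := by
  simp only [besselK, coshMoment]
  rw [← integral_const_mul, ← integral_sub ((integrableOn_exp_mul_cosh_pow hx 2).const_mul 2)
    (integrableOn_exp_mul_cosh_pow hx 0)]
  congr 1 with t
  push_cast
  rw [Real.cosh_two_mul, Real.sinh_sq]
  ring

lemma besselK_zero_pos {x : ℝ} (hx : 0 < x) : 0 < besselK 0 x := by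
  rw [besselK_zero]; exact coshMoment_pos hx 0

lemma besselK_one_pos {x : ℝ} (hx : 0 < x) : 0 < besselK 1 x := by
  rw [besselK_one]; exact coshMoment_pos hx 1

/-- Integration by parts for `∫ sinh² t e^{−x cosh t} dt`. -/
lemma mul_coshMoment_two_sub {x : ℝ} (hx : 0 < x) :
    x * (coshMoment 2 x - coshMoment 0 x) = coshMoment 1 x := by
  have hi := integrableOn_exp_mul_cosh_pow hx
  have h := integral_Ioi_of_hasDerivAt_of_tendsto (a := 0) (m := 0)
    (f := fun t => Real.exp (-x * Real.cosh t) * Real.sinh t)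
    (f' := fun t => Real.exp (-x * Real.cosh t) * Real.cosh t ^ 1
      - x * (Real.exp (-x * Real.cosh t) * Real.cosh t ^ 2
        - Real.exp (-x * Real.cosh t) * Real.cosh t ^ 0))
    (by fun_prop) (fun t _ => ?_) ((hi 1).sub' (((hi 2).sub' (hi 0)).const_mul x)) ?_
  · rw [integral_sub (hi 1) (((hi 2).sub' (hi 0)).const_mul x), integral_const_mul,
      integral_sub (hi 2) (hi 0)] at h
    simp only [coshMoment]
    simp only [Real.sinh_zero, mul_zero, sub_zero] at h
    linarith
  · refine (((Real.hasDerivAt_cosh t).const_mul (-x)).exp.mul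
      (Real.hasDerivAt_sinh t)).congr_deriv ?_
    rw [Real.cosh_sq t]
    ring
  · refine squeeze_zero_norm (fun t => ?_) (tendsto_exp_mul_cosh_pow hx 1)
    rw [norm_mul, Real.norm_of_nonneg (Real.exp_pos _).le, pow_one, Real.norm_eq_abs]
    gcongr
    rw [abs_le]
    constructor
    · have := Real.sinh_lt_cosh (-t)
      rw [Real.sinh_neg, Real.cosh_neg] at this
      linarith
    · exact (Real.sinh_lt_cosh t).le

lemma besselK_two_eq {x : ℝ} (hx : 0 < x) :
    besselK 2 x = besselK 0 x + 2 * besselK 1 x / x := by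
  rw [besselK_two hx, besselK_zero, besselK_one, ← mul_coshMoment_two_sub hx]
  field_simp
  ring

/-- Cauchy–Schwarz for the moments. -/
lemma coshMoment_one_sq_le {x : ℝ} (hx : 0 < x) :
    coshMoment 1 x ^ 2 ≤ coshMoment 0 x * coshMoment 2 x := by
  have hi := integrableOn_exp_mul_cosh_pow hx
  have h : 0 ≤ ∫ t in Set.Ioi (0:ℝ), (coshMoment 1 x ^ 2 *
      (Real.exp (-x * Real.cosh t) * Real.cosh t ^ 0)
      - 2 * coshMoment 0 x * coshMoment 1 x * (Real.exp (-x * Real.cosh t) * Real.cosh t ^ 1))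
      + coshMoment 0 x ^ 2 * (Real.exp (-x * Real.cosh t) * Real.cosh t ^ 2) := by
    refine integral_nonneg fun t => ?_
    have : 0 ≤ Real.exp (-x * Real.cosh t) *
        (coshMoment 1 x - coshMoment 0 x * Real.cosh t) ^ 2 := by positivity
    simp only [Pi.zero_apply]
    linarith
  rw [integral_add (((hi 0).const_mul _).sub' ((hi 1).const_mul _)) ((hi 2).const_mul _),
    integral_sub ((hi 0).const_mul _) ((hi 1).const_mul _), integral_const_mul,
    integral_const_mul, integral_const_mul] at h
  change 0 ≤ coshMoment 1 x ^ 2 * coshMoment 0 x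
    - 2 * coshMoment 0 x * coshMoment 1 x * coshMoment 1 x
    + coshMoment 0 x ^ 2 * coshMoment 2 x at h
  refine le_of_mul_le_mul_left ?_ (coshMoment_pos hx 0)
  linarith

lemma coshMoment_zero_le_one {x : ℝ} (hx : 0 < x) : coshMoment 0 x ≤ coshMoment 1 x := by
  refine integral_mono (integrableOn_exp_mul_cosh_pow hx 0) (integrableOn_exp_mul_cosh_pow hx 1)
    fun t => ?_
  have := Real.one_le_cosh t
  simp only [pow_zero, pow_one]
  gcongr

/-- Integration by parts against `tanh (t / 2)`, followed by `1 / (1 + c) ≥ (3 - c) / 4`. -/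
lemma three_mul_coshMoment_zero_sub_le {x : ℝ} (hx : 0 < x) :
    3 * coshMoment 0 x - coshMoment 1 x ≤ 4 * x * (coshMoment 1 x - coshMoment 0 x) := by
  have hi := integrableOn_exp_mul_cosh_pow hx
  have hc : ∀ t, 1 ≤ Real.cosh t := Real.one_le_cosh
  have hinv : IntegrableOn (fun t => Real.exp (-x * Real.cosh t) * (1 / (1 + Real.cosh t)))
      (Set.Ioi 0) := by
    refine (hi 0).mono' ?_ ?_
    · refine Continuous.aestronglyMeasurable ?_
      have : ∀ t, 1 + Real.cosh t ≠ 0 := fun t => by linarith [hc t]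
      fun_prop (disch := exact this)
    · refine Filter.Eventually.of_forall fun t => ?_
      have := hc t
      rw [Real.norm_of_nonneg (by positivity), pow_zero]
      gcongr
      rw [div_le_one (by linarith)]
      linarith
  have h := integral_Ioi_of_hasDerivAt_of_tendsto (a := 0) (m := 0)
    (f := fun t => Real.exp (-x * Real.cosh t) * (Real.sinh t / (1 + Real.cosh t)))
    (f' := fun t => Real.exp (-x * Real.cosh t) * (1 / (1 + Real.cosh t))
      - x * (Real.exp (-x * Real.cosh t) * Real.cosh t ^ 1
        - Real.exp (-x * Real.cosh t) * Real.cosh t ^ 0))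
    ?_ (fun t _ => ?_) (hinv.sub (((hi 1).sub' (hi 0)).const_mul x)) ?_
  · rw [integral_sub hinv (((hi 1).sub' (hi 0)).const_mul x), integral_const_mul,
      integral_sub (hi 1) (hi 0)] at h
    change _ - x * (coshMoment 1 x - coshMoment 0 x) = _ at h
    have h2 : ∫ t in Set.Ioi (0:ℝ), (3 / 4 * (Real.exp (-x * Real.cosh t) * Real.cosh t ^ 0)
        - 1 / 4 * (Real.exp (-x * Real.cosh t) * Real.cosh t ^ 1)) ≤
        ∫ t in Set.Ioi (0:ℝ), Real.exp (-x * Real.cosh t) * (1 / (1 + Real.cosh t)) := by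
      refine integral_mono (((hi 0).const_mul _).sub' ((hi 1).const_mul _)) hinv fun t => ?_
      have h3 : 3 / 4 - 1 / 4 * Real.cosh t ≤ 1 / (1 + Real.cosh t) := by
        rw [le_div_iff₀ (by linarith [hc t])]
        nlinarith [sq_nonneg (Real.cosh t - 1)]
      have := mul_le_mul_of_nonneg_left h3 (Real.exp_pos (-x * Real.cosh t)).le
      simp only [pow_zero, pow_one]
      linarith
    rw [integral_sub ((hi 0).const_mul _) ((hi 1).const_mul _), integral_const_mul,
      integral_const_mul] at h2
    change 3 / 4 * coshMoment 0 x - 1 / 4 * coshMoment 1 x ≤ _ at h2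
    simp only [Real.sinh_zero, zero_div, mul_zero, sub_zero] at h
    linarith
  · have : ∀ t, 1 + Real.cosh t ≠ 0 := fun t => by linarith [hc t]
    refine Continuous.continuousWithinAt ?_
    fun_prop (disch := exact this)
  · have h1 : 1 + Real.cosh t ≠ 0 := by linarith [hc t]
    refine (((Real.hasDerivAt_cosh t).const_mul (-x)).exp.mul
      ((Real.hasDerivAt_sinh t).div ((Real.hasDerivAt_cosh t).const_add 1) h1)).congr_deriv ?_
    rw [Pi.div_apply]
    field_simp
    linear_combination (-(1 + x * (1 + Real.cosh t))) * Real.sinh_sq t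
  · refine squeeze_zero_norm (fun t => ?_) (tendsto_exp_mul_cosh_pow hx 0)
    have h0 := hc t
    rw [norm_mul, Real.norm_of_nonneg (Real.exp_pos _).le, pow_zero, norm_div,
      Real.norm_of_nonneg (by linarith : 0 ≤ 1 + Real.cosh t), Real.norm_eq_abs]
    gcongr
    rw [div_le_one (by linarith), abs_le]
    constructor
    · have := Real.sinh_lt_cosh (-t)
      rw [Real.sinh_neg, Real.cosh_neg] at this
      linarith
    · linarith [Real.sinh_lt_cosh t]

lemma coshMoment_one_le_inv {x : ℝ} (hx : 0 < x) : coshMoment 1 x ≤ 1 / x := by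
  have hs : Filter.Tendsto Real.sinh Filter.atTop Filter.atTop := by
    refine Filter.tendsto_atTop_mono' _ ?_ Filter.tendsto_id
    filter_upwards [Filter.eventually_ge_atTop 0] with t ht
    exact Real.self_le_sinh_iff.2 ht
  have hd : ∀ t ∈ Set.Ioi (0:ℝ), HasDerivAt (fun t => -(1 / x) * Real.exp (-x * Real.sinh t))
      (Real.exp (-x * Real.sinh t) * Real.cosh t) t := fun t _ => by
    refine (((Real.hasDerivAt_sinh t).const_mul (-x)).exp.const_mul (-(1 / x))).congr_deriv ?_
    field_simp
  have hn : ∀ t ∈ Set.Ioi (0:ℝ), 0 ≤ Real.exp (-x * Real.sinh t) * Real.cosh t := fun t _ => by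
    have := Real.cosh_pos t
    positivity
  have ht : Filter.Tendsto (fun t => -(1 / x) * Real.exp (-x * Real.sinh t)) Filter.atTop
      (nhds 0) := by
    have := (Real.tendsto_exp_atBot.comp
      (hs.const_mul_atTop_of_neg (neg_neg_of_pos hx))).const_mul (-(1 / x))
    simpa using this
  have hcont : ContinuousWithinAt (fun t => -(1 / x) * Real.exp (-x * Real.sinh t))
      (Set.Ici 0) 0 := by fun_prop
  have hint := integrableOn_Ioi_deriv_of_nonneg hcont hd hn ht
  have h := integral_Ioi_of_hasDerivAt_of_nonneg hcont hd hn ht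
  calc coshMoment 1 x ≤ ∫ t in Set.Ioi (0:ℝ), Real.exp (-x * Real.sinh t) * Real.cosh t := by
        refine integral_mono (integrableOn_exp_mul_cosh_pow hx 1) hint fun t => ?_
        have := Real.cosh_pos t
        have := (Real.sinh_lt_cosh t).le
        simp only [pow_one, neg_mul]
        gcongr
    _ = 1 / x := by rw [h]; simp

lemma exp_neg_one_mul_log_le_coshMoment_zero {x : ℝ} (hx : 0 < x) (hx1 : x < 1) :
    Real.exp (-1) * (-Real.log x) ≤ coshMoment 0 x := by
  have hl : Real.log x < 0 := Real.log_neg hx hx1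
  have hi := integrableOn_exp_mul_cosh_pow hx 0
  calc Real.exp (-1) * (-Real.log x)
      = ∫ _t in Set.Ioc (0:ℝ) (-Real.log x), Real.exp (-1) := by
        simp [hl.le, mul_comm]
    _ ≤ ∫ t in Set.Ioc (0:ℝ) (-Real.log x), Real.exp (-x * Real.cosh t) * Real.cosh t ^ 0 := by
        refine setIntegral_mono_on (by simp) (hi.mono_set Set.Ioc_subset_Ioi_self)
          measurableSet_Ioc fun t ht => ?_
        rw [pow_zero, mul_one]
        refine Real.exp_le_exp.2 ?_
        have h1 : Real.exp t ≤ x⁻¹ := by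
          rw [← Real.exp_log (inv_pos.2 hx), Real.log_inv]
          exact Real.exp_le_exp.2 ht.2
        have h2 : Real.cosh t ≤ Real.exp t := by
          rw [Real.cosh_eq]
          have := Real.exp_le_exp.2 (by linarith [ht.1] : -t ≤ t)
          linarith
        have := mul_le_mul_of_nonneg_left (h2.trans h1) hx.le
        rw [mul_inv_cancel₀ hx.ne'] at this
        linarith
    _ ≤ coshMoment 0 x :=
        setIntegral_mono_set hi (Filter.Eventually.of_forall fun t => by simp; positivity)
          (Filter.Eventually.of_forall Set.Ioc_subset_Ioi_self)

/-- `x ↦ K₀(x) / K₁(x)`. -/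
def besselRatio (x : ℝ) : ℝ := besselK 0 x / besselK 1 x

lemma besselRatio_pos {x : ℝ} (hx : 0 < x) : 0 < besselRatio x :=
  div_pos (besselK_zero_pos hx) (besselK_one_pos hx)

lemma besselRatio_le_one {x : ℝ} (hx : 0 < x) : besselRatio x ≤ 1 := by
  rw [besselRatio, div_le_one (besselK_one_pos hx), besselK_zero, besselK_one]
  exact coshMoment_zero_le_one hx

lemma le_mul_besselRatio_sq_add {x : ℝ} (hx : 0 < x) :
    x ≤ x * besselRatio x ^ 2 + besselRatio x := by
  have h0 := coshMoment_pos hx 0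
  have h1 := coshMoment_pos hx 1
  have h := mul_le_mul_of_nonneg_left (coshMoment_one_sq_le hx) hx.le
  have h2 := mul_coshMoment_two_sub hx
  rw [besselRatio, besselK_zero, besselK_one]
  have : x * (coshMoment 0 x / coshMoment 1 x) ^ 2 + coshMoment 0 x / coshMoment 1 x
      = (x * coshMoment 0 x ^ 2 + coshMoment 0 x * coshMoment 1 x) / coshMoment 1 x ^ 2 := by
    field_simp
  rw [this, le_div_iff₀ (by positivity), ← h2]
  rw [← h2] at h
  linarith

lemma three_mul_besselRatio_sub_le {x : ℝ} (hx : 0 < x) :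
    3 * besselRatio x - 1 ≤ 4 * x * (1 - besselRatio x) := by
  have h1 := coshMoment_pos hx 1
  have h := three_mul_coshMoment_zero_sub_le hx
  have e : coshMoment 0 x = besselRatio x * coshMoment 1 x := by
    rw [besselRatio, besselK_zero, besselK_one, div_mul_cancel₀ _ h1.ne']
  rw [e] at h
  refine le_of_mul_le_mul_right ?_ h1
  linarith

lemma div_one_add_le_besselRatio {x : ℝ} (hx : 0 < x) : x / (1 + x) ≤ besselRatio x := by
  rw [div_le_iff₀ (by linarith)]
  have hr := besselRatio_pos hx
  have hr1 := besselRatio_le_one hx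
  have h := le_mul_besselRatio_sq_add hx
  nlinarith [mul_nonneg hx.le (mul_nonneg hr.le (sub_nonneg.2 hr1))]

lemma half_le_besselRatio {x : ℝ} (hx : 1 ≤ x) : 1 / 2 ≤ besselRatio x := by
  refine le_trans ?_ (div_one_add_le_besselRatio (by linarith))
  rw [div_le_div_iff₀ (by norm_num) (by linarith)]
  linarith

lemma mul_neg_log_le_besselRatio {x : ℝ} (hx : 0 < x) (hx1 : x < 1) :
    x * (-Real.log x) ≤ 3 * besselRatio x := by
  have h1 := coshMoment_pos hx 1
  have h0 := coshMoment_pos hx 0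
  have hK := coshMoment_one_le_inv hx
  have hL := exp_neg_one_mul_log_le_coshMoment_zero hx hx1
  have he : Real.exp 1 * Real.exp (-1) = 1 := by rw [← Real.exp_add]; simp
  have he3 : Real.exp 1 < 3 := by linarith [Real.exp_one_lt_d9]
  have h2 : -Real.log x ≤ 3 * coshMoment 0 x := by
    have := mul_le_mul_of_nonneg_left hL (Real.exp_pos 1).le
    rw [← mul_assoc, he, one_mul] at this
    nlinarith
  rw [besselRatio, besselK_zero, besselK_one, ← mul_div_assoc, le_div_iff₀ h1]
  have hl : 0 ≤ -Real.log x := by linarith [Real.log_neg hx hx1]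
  calc x * -Real.log x * coshMoment 1 x ≤ x * -Real.log x * (1 / x) := by gcongr
    _ = -Real.log x := by field_simp
    _ ≤ _ := h2

lemma mul_logn_le_besselRatio {ε x : ℝ} (hε : 0 < ε) (hεx : ε ≤ x) :
    ε * logn ε ≤ 5 * besselRatio x := by
  have hx : 0 < x := hε.trans_le hεx
  unfold logn
  rcases lt_or_ge x 1 with hx1 | hx1
  · have h1 := mul_neg_log_le_besselRatio hx hx1
    have h2 := div_one_add_le_besselRatio hx
    rw [div_le_iff₀ (by linarith)] at h2
    have hr := besselRatio_pos hx
    have h3 : ε * (Real.log x - Real.log ε) ≤ x - ε := by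
      rw [← Real.log_div hx.ne' hε.ne']
      have := mul_le_mul_of_nonneg_left (Real.log_le_sub_one_of_pos (div_pos hx hε)) hε.le
      rwa [mul_sub, mul_div_cancel₀ _ hε.ne', mul_one] at this
    have hl : 0 ≤ -Real.log x := by linarith [Real.log_neg hx hx1]
    have h4 := mul_le_mul_of_nonneg_right hεx hl
    nlinarith
  · have h1 := half_le_besselRatio hx1
    have h2 : -Real.log ε ≤ ε⁻¹ - 1 := by
      rw [← Real.log_inv]; exact Real.log_le_sub_one_of_pos (inv_pos.2 hε)
    have h3 := mul_le_mul_of_nonneg_left h2 hε.le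
    rw [mul_sub, mul_inv_cancel₀ hε.ne'] at h3
    linarith

lemma besselRatio_div_le_mt {ε : ℝ} (hε : 0 < ε) {k : ℤ} (hk : k ≠ 0) :
    besselRatio (2 * π * ε * |(k : ℝ)|) / (4 * π * (2 * π * ε * |(k : ℝ)|)) ≤ mt ε k := by
  have hk' : 0 < |(k : ℝ)| := abs_pos.2 (Int.cast_ne_zero.2 hk)
  have hπ := Real.pi_pos
  have hx : 0 < 2 * π * ε * |(k : ℝ)| := by positivity
  simp only [mt, if_neg hk]
  have e : 8 * π ^ 2 * ε * |(k : ℝ)| = 4 * π * (2 * π * ε * |(k : ℝ)|) := by ring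
  rw [e]
  generalize 2 * π * ε * |(k : ℝ)| = x at *
  have h1 := besselK_one_pos hx
  have h := le_mul_besselRatio_sq_add hx
  have e0 : besselK 0 x = besselRatio x * besselK 1 x := by
    rw [besselRatio, div_mul_cancel₀ _ h1.ne']
  rw [e0]
  have e2 : (2 * (besselRatio x * besselK 1 x) * besselK 1 x
      + x * ((besselRatio x * besselK 1 x) ^ 2 - besselK 1 x ^ 2))
      / (4 * π * x * besselK 1 x ^ 2)
      = (2 * besselRatio x + x * (besselRatio x ^ 2 - 1)) / (4 * π * x) := by
    field_simp
  rw [e2]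
  gcongr
  linarith

lemma besselRatio_div_le_mn {ε : ℝ} (hε : 0 < ε) {k : ℤ} (hk : k ≠ 0) :
    besselRatio (2 * π * ε * |(k : ℝ)|) / (176 * π * (2 * π * ε * |(k : ℝ)|)) ≤ mn ε k := by
  have hk' : 0 < |(k : ℝ)| := abs_pos.2 (Int.cast_ne_zero.2 hk)
  have hπ := Real.pi_pos
  have hx : 0 < 2 * π * ε * |(k : ℝ)| := by positivity
  simp only [mn, if_neg hk]
  have e : 4 * π ^ 2 * ε * |(k : ℝ)| = 2 * π * (2 * π * ε * |(k : ℝ)|) := by ring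
  rw [e]
  generalize 2 * π * ε * |(k : ℝ)| = x at *
  have h1 := besselK_one_pos hx
  have h := le_mul_besselRatio_sq_add hx
  have h3 := three_mul_besselRatio_sub_le hx
  have hr := besselRatio_pos hx
  have hr1 := besselRatio_le_one hx
  have hhalf : 1 ≤ x → 1 / 2 ≤ besselRatio x := half_le_besselRatio
  have e0 : besselK 0 x = besselRatio x * besselK 1 x := by
    rw [besselRatio, div_mul_cancel₀ _ h1.ne']
  rw [besselK_two_eq hx, e0]
  generalize besselRatio x = r at *
  generalize besselK 1 x = K at *
  have hD : 0 < 2 * r * x + 8 + x ^ 2 * (1 - r ^ 2) := by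
    have : 0 ≤ 1 - r ^ 2 := by nlinarith
    positivity
  have hxr : x ^ 2 * (1 - r ^ 2) ≤ x * r := by nlinarith
  have e2 : (2 * (r * K) * K * (r * K + 2 * K / x)
      + x * (K ^ 2 * (r * K + (r * K + 2 * K / x)) - 2 * (r * K) ^ 2 * (r * K + 2 * K / x)))
      / (2 * π * x * (4 * K ^ 2 * (r * K + 2 * K / x)
        + x * K * (K ^ 2 - r * K * (r * K + 2 * K / x))))
      = (4 * r + 2 * x * (1 - r ^ 2) * (1 + x * r)) / (2 * r * x + 8 + x ^ 2 * (1 - r ^ 2))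
        / (2 * π * x) := by
    have e3 : 2 * π * x * (4 * K ^ 2 * (r * K + 2 * K / x)
        + x * K * (K ^ 2 - r * K * (r * K + 2 * K / x)))
        = 2 * π * K ^ 3 * (2 * r * x + 8 + x ^ 2 * (1 - r ^ 2)) := by
      field_simp
      ring
    rw [e3, div_div, div_eq_div_iff (by positivity) (by positivity)]
    field_simp
    ring
  rw [e2]
  have e4 : r / (176 * π * x) = r / 88 / (2 * π * x) := by field_simp; norm_num
  rw [e4]
  refine div_le_div_of_nonneg_right ?_ (by positivity)
  rw [div_le_div_iff₀ (by norm_num) hD]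
  have h1r : 0 ≤ 1 - r ^ 2 := by nlinarith
  rcases le_total x 1 with hx1 | hx1
  · have p : 0 ≤ 2 * x * (1 - r ^ 2) * (1 + x * r) := by positivity
    nlinarith [mul_nonneg hr.le (sub_nonneg.2 hx1), mul_nonneg (mul_nonneg hr.le hr.le) hx.le]
  · have hr2 := hhalf hx1
    have q1 : 1 / 2 ≤ 4 * x * (1 - r) := by linarith
    have q2 : 1 / 8 ≤ x * (1 - r ^ 2) := by nlinarith
    have q3 : 1 / 4 * (x * r) ≤ 2 * x * (1 - r ^ 2) * (1 + x * r) := by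
      have : 0 ≤ x * r := by positivity
      nlinarith
    nlinarith [mul_nonneg hx.le hr.le, mul_nonneg (mul_nonneg hx.le hr.le) (sub_nonneg.2 hr1)]

/-- Uniform lower bound for both slender body multipliers. -/
lemma logn_div_sqrt_le {ε : ℝ} (hε : ε ∈ Set.Ioo (0:ℝ) (1/2)) (k : ℤ) :
    1 / 40000 * logn ε / √(1 + (k : ℝ) ^ 2) ≤ mt ε k ∧
      1 / 40000 * logn ε / √(1 + (k : ℝ) ^ 2) ≤ mn ε k := by
  obtain ⟨hε0, hε1⟩ := hε
  have hπ := Real.pi_pos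
  have hπ3 := Real.pi_gt_three
  have hπ4 := Real.pi_le_four
  have hL : 0 < logn ε := neg_pos.2 (Real.log_neg hε0 (by linarith))
  by_cases hk : k = 0
  · subst hk
    simp only [mt, mn, if_true, Int.cast_zero]
    norm_num
    constructor
    · rw [le_div_iff₀ (by positivity)]; nlinarith
    · rw [le_div_iff₀ (by positivity)]; nlinarith
  · have hk' : 0 < |(k : ℝ)| := abs_pos.2 (Int.cast_ne_zero.2 hk)
    have hk1 : 1 ≤ |(k : ℝ)| := by exact_mod_cast Int.one_le_abs hk
    have hs : |(k : ℝ)| ≤ √(1 + (k : ℝ) ^ 2) := Real.abs_le_sqrt (by linarith)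
    have hx : 0 < 2 * π * ε * |(k : ℝ)| := by positivity
    have hεx : ε ≤ 2 * π * ε * |(k : ℝ)| := by
      have : 1 ≤ 2 * π * |(k : ℝ)| := by nlinarith
      nlinarith
    have hr := mul_logn_le_besselRatio hε0 hεx
    have hr0 := besselRatio_pos hx
    have key : 1 / 40000 * logn ε / √(1 + (k : ℝ) ^ 2) ≤
        besselRatio (2 * π * ε * |(k : ℝ)|) / (176 * π * (2 * π * ε * |(k : ℝ)|)) := by
      calc 1 / 40000 * logn ε / √(1 + (k : ℝ) ^ 2) ≤ 1 / 40000 * logn ε / |(k : ℝ)| := by gcongr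
        _ ≤ (ε * logn ε / 5) / (176 * π * (2 * π * ε * |(k : ℝ)|)) := by
          have e : (ε * logn ε / 5) / (176 * π * (2 * π * ε * |(k : ℝ)|))
              = 1 / (1760 * π ^ 2) * logn ε / |(k : ℝ)| := by field_simp; norm_num
          rw [e]
          gcongr
          nlinarith
        _ ≤ _ := by gcongr; linarith
    refine ⟨key.trans (le_trans ?_ (besselRatio_div_le_mt hε0 hk)),
      key.trans (besselRatio_div_le_mn hε0 hk)⟩
    gcongr
    norm_num

lemma integral_exp_int_mul (n : ℤ) :
    ∫ s in (0:ℝ)..1, Complex.exp (2 * (π : ℂ) * Complex.I * (n : ℂ) * (s : ℂ)) =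
      if n = 0 then 1 else 0 := by
  split_ifs with h
  · simp [h]
  · rw [integral_exp_mul_complex (by simp [h, Real.pi_ne_zero, Complex.I_ne_zero])]
    have : 2 * (π : ℂ) * Complex.I * (n : ℂ) * ((1 : ℝ) : ℂ) = n * (2 * π * Complex.I) := by
      push_cast; ring
    rw [this, Complex.exp_int_mul_two_pi_mul_I]
    simp

lemma norm_exp_neg_two_pi (k : ℤ) (s : ℝ) :
    ‖Complex.exp (-(2 * (π : ℂ) * Complex.I * (k : ℂ) * (s : ℂ)))‖ = 1 := by
  have : -(2 * (π : ℂ) * Complex.I * (k : ℂ) * (s : ℂ))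
      = ((-(2 * π * k * s) : ℝ) : ℂ) * Complex.I := by
    push_cast; ring
  rw [this, Complex.norm_exp_ofReal_mul_I]

lemma norm_exp_two_pi (k : ℤ) (s : ℝ) :
    ‖Complex.exp (2 * (π : ℂ) * Complex.I * (k : ℂ) * (s : ℂ))‖ = 1 := by
  have := norm_exp_neg_two_pi (-k) s
  simpa using this

/-- The Fourier coefficients of an absolutely convergent Fourier series. -/
lemma fc_tsum {a : ℤ → ℂ} (ha : Summable fun k => ‖a k‖) (j : ℤ) :
    fc (fun s => ∑' k : ℤ, a k *
      Complex.exp (-(2 * (π : ℂ) * Complex.I * (k : ℂ) * (s : ℂ)))) j = a j := by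
  have h := intervalIntegral.tsum_intervalIntegral_eq_of_summable_norm (a := 0) (b := 1)
    (f := fun k : ℤ => (⟨fun s : ℝ => a k *
      Complex.exp (-(2 * (π : ℂ) * Complex.I * (k : ℂ) * (s : ℂ))) *
      Complex.exp (2 * (π : ℂ) * Complex.I * (j : ℂ) * (s : ℂ)), by fun_prop⟩ : C(ℝ, ℂ))) ?_
  · simp only [ContinuousMap.coe_mk] at h
    simp only [fc]
    simp_rw [← tsum_mul_right]
    rw [← h]
    have e : ∀ k : ℤ, ∫ s in (0:ℝ)..1, a k *
        Complex.exp (-(2 * (π : ℂ) * Complex.I * (k : ℂ) * (s : ℂ))) *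
        Complex.exp (2 * (π : ℂ) * Complex.I * (j : ℂ) * (s : ℂ)) =
        if k = j then a j else 0 := fun k => by
      have e1 : ∀ s : ℝ, a k * Complex.exp (-(2 * (π : ℂ) * Complex.I * (k : ℂ) * (s : ℂ))) *
          Complex.exp (2 * (π : ℂ) * Complex.I * (j : ℂ) * (s : ℂ)) =
          a k * Complex.exp (2 * (π : ℂ) * Complex.I * ((j - k : ℤ) : ℂ) * (s : ℂ)) := fun s => by
        rw [mul_assoc, ← Complex.exp_add]
        congr 2
        push_cast
        ring
      simp_rw [e1]
      rw [intervalIntegral.integral_const_mul, integral_exp_int_mul]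
      by_cases hkj : k = j
      · simp [hkj]
      · have : j - k ≠ 0 := fun h => hkj (by omega)
        simp [hkj, this]
    simp_rw [e]
    exact tsum_ite_eq j _
  · refine ha.of_nonneg_of_le (fun _ => norm_nonneg _) fun k => ?_
    refine (ContinuousMap.norm_le _ (norm_nonneg _)).2 fun s => ?_
    simp [norm_exp_neg_two_pi, norm_exp_two_pi]

lemma conj_fc_ofReal (h : ℝ → ℝ) (k : ℤ) :
    (starRingEnd ℂ) (fc (fun s => (h s : ℂ)) k) = fc (fun s => (h s : ℂ)) (-k) := by
  simp only [fc, intervalIntegral.integral_of_le zero_le_one]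
  rw [← integral_conj]
  congr 1 with s
  rw [map_mul, Complex.conj_ofReal, ← Complex.exp_conj]
  simp [map_ofNat (starRingEnd ℂ) 2]

lemma conj_TmC {m : ℤ → ℝ} (hm : ∀ k, m (-k) = m k) (h : ℝ → ℝ) (s : ℝ) :
    (starRingEnd ℂ) (TmC m (fun t => (h t : ℂ)) s) = TmC m (fun t => (h t : ℂ)) s := by
  simp only [TmC]
  rw [Complex.conj_tsum, ← (Equiv.neg ℤ).tsum_eq]
  congr 1 with k
  rw [map_mul, map_mul, Complex.conj_ofReal, conj_fc_ofReal, ← Complex.exp_conj]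
  simp [hm, map_ofNat (starRingEnd ℂ) 2]

/-- The coefficients of `T_m h` are controlled by those of `h`, with equality when the defining
series converges. -/
lemma norm_fc_re_TmC_le {m : ℤ → ℝ} (hm : ∀ k, m (-k) = m k) (h : ℝ → ℝ) (j : ℤ) :
    ‖fc (fun s => (((TmC m (fun t => (h t : ℂ)) s).re : ℝ) : ℂ)) j‖ ≤
      |m j| * ‖fc (fun t => (h t : ℂ)) j‖ := by
  have e : (fun s => (((TmC m (fun t => (h t : ℂ)) s).re : ℝ) : ℂ))
      = TmC m (fun t => (h t : ℂ)) :=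
    funext fun s => Complex.conj_eq_iff_re.1 (conj_TmC hm h s)
  rw [e]
  by_cases hs : Summable fun k : ℤ => ‖(m k : ℂ) * fc (fun t => (h t : ℂ)) k‖
  · have : fc (TmC m fun t => (h t : ℂ)) j = m j * fc (fun t => (h t : ℂ)) j := fc_tsum hs j
    rw [this, norm_mul, Complex.norm_real, Real.norm_eq_abs]
  · have : TmC m (fun t => (h t : ℂ)) = fun _ => 0 := by
      funext s
      refine tsum_eq_zero_of_not_summable fun hs' => hs ?_
      have := hs'.norm
      simpa only [norm_mul _ (Complex.exp _), norm_exp_neg_two_pi, mul_one] using this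
    rw [this]
    simp only [fc, zero_mul, intervalIntegral.integral_zero, norm_zero]
    positivity

lemma norm_sq_fcV_Tm_le {m : ℤ → ℝ} (hm : ∀ k, m (-k) = m k) (f : ℝ → V) (k : ℤ) :
    ‖fcV (Tm m f) k‖ ^ 2 ≤ m k ^ 2 * ‖fcV f k‖ ^ 2 := by
  rw [EuclideanSpace.norm_sq_eq, EuclideanSpace.norm_sq_eq, Finset.mul_sum]
  refine Finset.sum_le_sum fun i _ => ?_
  rw [← sq_abs (m k), ← mul_pow]
  exact pow_le_pow_left₀ (norm_nonneg _) (norm_fc_re_TmC_le hm (fun t => f t i) k) 2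

lemma HnV_Tm_le {m : ℤ → ℝ} (hm : ∀ k, m (-k) = m k) {C ℓ θ : ℝ} (hC : 0 ≤ C)
    (hmC : ∀ k, |m k| ≤ C * (1 + (k : ℝ) ^ 2) ^ (θ / 2)) {f : ℝ → V}
    (hf : MemHV (ℓ + θ) f) : HnV ℓ (Tm m f) ≤ C * HnV (ℓ + θ) f := by
  have hle : ∀ k : ℤ, (1 + (k : ℝ) ^ 2) ^ ℓ * ‖fcV (Tm m f) k‖ ^ 2 ≤
      C ^ 2 * ((1 + (k : ℝ) ^ 2) ^ (ℓ + θ) * ‖fcV f k‖ ^ 2) := fun k => by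
    have hp : 0 < 1 + (k : ℝ) ^ 2 := by positivity
    have h1 : m k ^ 2 ≤ C ^ 2 * (1 + (k : ℝ) ^ 2) ^ θ := by
      have h2 := pow_le_pow_left₀ (abs_nonneg _) (hmC k) 2
      rwa [sq_abs, mul_pow, ← Real.rpow_mul_natCast hp.le, Nat.cast_ofNat,
        div_mul_cancel₀ _ (two_ne_zero)] at h2
    calc _ ≤ (1 + (k : ℝ) ^ 2) ^ ℓ * (C ^ 2 * (1 + (k : ℝ) ^ 2) ^ θ * ‖fcV f k‖ ^ 2) := by
          gcongr
          exact (norm_sq_fcV_Tm_le hm f k).trans (by gcongr)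
      _ = _ := by rw [Real.rpow_add hp]; ring
  have hs : Summable fun k : ℤ =>
      C ^ 2 * ((1 + (k : ℝ) ^ 2) ^ (ℓ + θ) * ‖fcV f k‖ ^ 2) := hf.mul_left _
  have hs' := hs.of_nonneg_of_le (fun k => by positivity) hle
  rw [HnV, HnV]
  refine Real.sqrt_le_iff.2 ⟨by positivity, ?_⟩
  have hnn : 0 ≤ HsqV (ℓ + θ) f := tsum_nonneg fun k => by positivity
  rw [mul_pow, Real.sq_sqrt hnn, HsqV, HsqV, ← tsum_mul_left]
  exact hs'.tsum_le_tsum hle hs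

lemma mt_neg (ε : ℝ) (k : ℤ) : mt ε (-k) = mt ε k := by simp [mt]

lemma mn_neg (ε : ℝ) (k : ℤ) : mn ε (-k) = mn ε k := by simp [mn]

lemma abs_rpow_neg_le {a L m p θ : ℝ} (ha : 0 < a) (hL : 0 < L) (hp : 0 < p) (hθ : 0 ≤ θ)
    (h : a * L / √p ≤ m) : |m ^ (-θ)| ≤ a ^ (-θ) * L ^ (-θ) * p ^ (θ / 2) := by
  have hq : 0 < √p := Real.sqrt_pos.2 hp
  have h0 : 0 < a * L / √p := by positivity
  rw [abs_of_nonneg (Real.rpow_nonneg (h0.le.trans h) _)]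
  refine (Real.rpow_le_rpow_of_nonpos h0 h (neg_nonpos.2 hθ)).trans_eq ?_
  rw [Real.div_rpow (by positivity) hq.le, Real.mul_rpow ha.le hL.le, Real.sqrt_eq_rpow,
    ← Real.rpow_mul hp.le, div_eq_mul_inv, ← Real.rpow_neg hp.le]
  congr 2
  ring

/-- **Inverse multiplier operators** (Lemma 4.1). -/
theorem inverse_multiplier_operators :
    ∀ θ : ℝ, 0 ≤ θ → ∃ c : ℝ, 0 < c ∧
      ∀ ε ∈ Set.Ioo (0:ℝ) (1/2), ∀ ℓ : ℝ, ∀ f : ℝ → V,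
        Function.Periodic f 1 → MemHV (ℓ + θ) f →
        HnV ℓ (Tm (fun k => (mt ε k) ^ (-θ)) f) ≤ c * (logn ε) ^ (-θ) * HnV (ℓ + θ) f ∧
        HnV ℓ (Tm (fun k => (mn ε k) ^ (-θ)) f) ≤ c * (logn ε) ^ (-θ) * HnV (ℓ + θ) f := by
  intro θ hθ
  have ha : (0:ℝ) < 1 / 40000 := by norm_num
  refine ⟨(1 / 40000) ^ (-θ), Real.rpow_pos_of_pos ha _, fun ε hε ℓ f _ hf => ?_⟩
  have hL : 0 < logn ε := neg_pos.2 (Real.log_neg hε.1 (by linarith [hε.2]))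
  have hC : 0 ≤ (1 / 40000 : ℝ) ^ (-θ) * logn ε ^ (-θ) := by positivity
  exact ⟨HnV_Tm_le (fun k => by rw [mt_neg]) hC
      (fun k => abs_rpow_neg_le ha hL (by positivity) hθ (logn_div_sqrt_le hε k).1) hf,
    HnV_Tm_le (fun k => by rw [mn_neg]) hC
      (fun k => abs_rpow_neg_le ha hL (by positivity) hθ (logn_div_sqrt_le hε k).2) hf⟩

end Filament
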